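/- Let B be a separable, reflexive, uniformly smooth Banach space which is I-smoothly weakly compact for an exponent p ∈ [2,∞). Let f : B → B be a continuous function admitting at most a linear growth (‖f(x)‖ ≤ L(1+‖x‖) for some L > 0 and all x), let r > 0, and let C be a nonempty, ball-compact, (r,f)-prox-regular subset of B. Then for every u₀ ∈ C, the system u̇(t) + N(C,u(t)) ∋ f(u(t)), u(0) = u₀, has an absolutely continuous solution u on I = [0,T] with u(t) ∈ C for all t ∈ I. -/

import Mathlib

open MeasureTheory Set Filter Topology

noncomputable section

/-- The (set-valued) metric projection onto `C`:
`P_C(y) = {z ∈ C | ‖y - z‖ = d(y,C)}`. -/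
def projSet {E : Type*} [NormedAddCommGroup E] (C : Set E) (y : E) : Set E :=
  {z | z ∈ C ∧ ‖y - z‖ = Metric.infDist y C}

/-- The proximal normal cone of `C` at `x`:
`N(C,x) = {v | ∃ s > 0, x ∈ P_C(x + s v)}`. -/
def proxNormalCone {E : Type*} [NormedAddCommGroup E] [NormedSpace ℝ E]
    (C : Set E) (x : E) : Set E :=
  {v | ∃ s : ℝ, 0 < s ∧ x ∈ projSet C (x + s • v)}

/-- `Γ^r(C,x) = {v | x ∈ P_C(x + r v)}`, the good directions to project at scale `r`. -/
def gammaSet {E : Type*} [NormedAddCommGroup E] [NormedSpace ℝ E]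
    (r : ℝ) (C : Set E) (x : E) : Set E :=
  {v | x ∈ projSet C (x + r • v)}

/-- `C` is `(r,f)`-prox-regular (`r`-prox-regular in the direction `f`): for all `x ∈ C`
and `s ∈ (0,r)`, the projection `z` of `x + s f(x)/‖f(x)‖` onto `C` is well defined
(single valued), and the normalized vector from `z` to `x + s f(x)/‖f(x)‖` belongs to
`Γ^r(C,z)` (with the convention `v/‖v‖ = 0` when `v = 0`). -/
def DirProxRegular {E : Type*} [NormedAddCommGroup E] [NormedSpace ℝ E]
    (r : ℝ) (f : E → E) (C : Set E) : Prop :=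
  ∀ x ∈ C, ∀ s : ℝ, 0 < s → s < r →
    ∃ z : E, projSet C (x + (s * ‖f x‖⁻¹) • f x) = {z} ∧
      ‖x + (s * ‖f x‖⁻¹) • f x - z‖⁻¹ • (x + (s * ‖f x‖⁻¹) • f x - z) ∈ gammaSet r C z

/-- A subset is ball-compact if its intersection with every closed ball is compact. -/
def BallCompact {E : Type*} [NormedAddCommGroup E] (C : Set E) : Prop :=
  ∀ (x : E) (R : ℝ), IsCompact (C ∩ Metric.closedBall x R)

/-- A uniformly smooth normed space: the norm is uniformly Fréchet differentiable away
from `0`, expressed through the vanishing of the modulus of smoothness. -/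
def UniformlySmooth (E : Type*) [NormedAddCommGroup E] [NormedSpace ℝ E] : Prop :=
  ∀ ε > (0:ℝ), ∃ δ > (0:ℝ), ∀ x y : E, ‖x‖ = 1 → ‖y‖ ≤ δ →
    ‖x + y‖ + ‖x - y‖ - 2 ≤ ε * ‖y‖

/-- A reflexive normed space: the canonical embedding into the double dual is onto. -/
def ReflexiveSpace (E : Type*) [NormedAddCommGroup E] [NormedSpace ℝ E] : Prop :=
  Function.Surjective (NormedSpace.inclusionInDoubleDual ℝ E)

/-- The normalized duality-type mapping `J_p(x) = (1/p) (∇‖·‖^p)(x) ∈ E*`. -/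
def dualMapJ {E : Type*} [NormedAddCommGroup E] [NormedSpace ℝ E]
    (p : ℝ) (x : E) : E →L[ℝ] ℝ :=
  p⁻¹ • fderiv ℝ (fun z : E => ‖z‖ ^ p) x

/-- `E` is `I`-smoothly weakly compact for the exponent `p`: from every bounded sequence of
`L^∞(I,E)` one can extract a subsequence weakly-* converging (through the duality
`L^∞(I,E) = (L¹(I,E*))*`) to some `y ∈ L^∞(I,E)` along which the integral quantities
built from `J_p` pass to the limit. -/
def ISmoothlyWeaklyCompact (I : Set ℝ)
    (E : Type*) [NormedAddCommGroup E] [NormedSpace ℝ E] (p : ℝ) : Prop :=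
  ∀ x : ℕ → ℝ → E,
    (∀ n, AEStronglyMeasurable (x n) (volume.restrict I)) →
    (∃ M : ℝ, ∀ n, ∀ᵐ t ∂volume.restrict I, ‖x n t‖ ≤ M) →
    ∃ k : ℕ → ℕ, StrictMono k ∧ ∃ y : ℝ → E,
      AEStronglyMeasurable y (volume.restrict I) ∧
      (∃ M : ℝ, ∀ᵐ t ∂volume.restrict I, ‖y t‖ ≤ M) ∧
      (∀ g : ℝ → (E →L[ℝ] ℝ), Integrable g (volume.restrict I) →
        Tendsto (fun n => ∫ t, g t (x (k n) t) ∂volume.restrict I) atTop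
          (𝓝 (∫ t, g t (y t) ∂volume.restrict I))) ∧
      (∀ z : ℝ → E, AEStronglyMeasurable z (volume.restrict I) →
        (∃ M : ℝ, ∀ᵐ t ∂volume.restrict I, ‖z t‖ ≤ M) →
        ∀ φ : ℝ → ℝ, Integrable φ (volume.restrict I) →
          Tendsto (fun n => ∫ t,
              (dualMapJ p (z t + x (k n) t) - dualMapJ p (x (k n) t)) (x (k n) t) * φ t
                ∂volume.restrict I) atTop
            (𝓝 (∫ t, (dualMapJ p (z t + y t) - dualMapJ p (y t)) (y t) * φ t
                ∂volume.restrict I)))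

/-- An absolutely continuous solution of the sweeping process
`u̇(t) + N(C(t),u(t)) ∋ f(u(t))`, `u(0) = u₀`, on `[0,T]`: `u` is absolutely continuous,
i.e. `u(t) = u₀ + ∫₀ᵗ g` for some Bochner-integrable density `g` (`g = u̇` a.e.),
`u(t) ∈ C(t)` for all `t ∈ [0,T]` and `f(u(t)) - u̇(t) ∈ N(C(t),u(t))` a.e. on `[0,T]`. -/
def IsSweepingSol {E : Type*} [NormedAddCommGroup E] [NormedSpace ℝ E] [CompleteSpace E]
    (C : ℝ → Set E) (f : E → E) (T : ℝ) (u₀ : E) (u : ℝ → E) : Prop :=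
  ∃ g : ℝ → E, IntegrableOn g (Set.Icc 0 T) ∧
    (∀ t ∈ Set.Icc (0:ℝ) T, u t = u₀ + ∫ s in (0:ℝ)..t, g s) ∧
    (∀ t ∈ Set.Icc (0:ℝ) T, u t ∈ C t) ∧
    (∀ᵐ t ∂volume.restrict (Set.Icc (0:ℝ) T),
      f (u t) - g t ∈ proxNormalCone (C t) (u t))

section DualMap

variable {E : Type*} [NormedAddCommGroup E] [NormedSpace ℝ E]

lemma UniformlySmooth.differentiableAt_norm_of_norm_eq_one (h : UniformlySmooth E) {x : E}
    (hx : ‖x‖ = 1) : DifferentiableAt ℝ (fun z : E => ‖z‖) x := by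
  obtain ⟨g, hg, hgx⟩ := exists_dual_vector'' ℝ x
  have hle : ∀ z, g z ≤ ‖z‖ := fun z =>
    (le_abs_self _).trans ((g.le_opNorm z).trans (by nlinarith [norm_nonneg z]))
  refine ⟨g, hasFDerivAt_iff_isLittleO_nhds_zero.2 (Asymptotics.isLittleO_iff.2 fun ε hε => ?_)⟩
  obtain ⟨δ, hδ, H⟩ := h ε hε
  filter_upwards [Metric.closedBall_mem_nhds (0 : E) hδ] with y hy
  have h1 := H x y hx (by simpa using hy)
  have h2 := hle (x + y)
  have h3 := hle (x - y)
  simp only [map_add, map_sub, hgx, hx, RCLike.ofReal_real_eq_id, id] at h2 h3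
  rw [hx, Real.norm_eq_abs, abs_le]
  constructor <;> nlinarith [norm_nonneg y]

lemma UniformlySmooth.differentiableAt_norm (h : UniformlySmooth E) {x : E} (hx : x ≠ 0) :
    DifferentiableAt ℝ (fun z : E => ‖z‖) x := by
  have hx' : ‖x‖ ≠ 0 := norm_ne_zero_iff.2 hx
  refine DifferentiableAt.differentiableAt_norm_of_smul (t := ‖x‖⁻¹) ?_
  exact h.differentiableAt_norm_of_norm_eq_one (by rw [norm_smul]; simp [hx'])

lemma hasFDerivAt_norm_rpow_zero {p : ℝ} (hp : 2 ≤ p) :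
    HasFDerivAt (fun z : E => ‖z‖ ^ p) (0 : E →L[ℝ] ℝ) 0 := by
  refine Asymptotics.IsBigO.hasFDerivAt (n := 2) ?_ one_lt_two
  refine Asymptotics.IsBigO.of_bound 1 ?_
  filter_upwards [Metric.closedBall_mem_nhds (0 : E) one_pos] with y hy
  have hy' : ‖y‖ ≤ 1 := by simpa using hy
  rw [sub_zero, one_mul, Real.norm_of_nonneg (by positivity), Real.norm_of_nonneg (by positivity),
    ← Real.rpow_two]
  exact Real.rpow_le_rpow_of_exponent_ge_of_imp (norm_nonneg _) hy' hp (by intros; linarith)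

lemma UniformlySmooth.hasFDerivAt_norm_rpow (h : UniformlySmooth E) {p : ℝ} (hp : 2 ≤ p) (x : E) :
    HasFDerivAt (fun z : E => ‖z‖ ^ p)
      (p • (‖x‖ ^ (p - 1) • fderiv ℝ (fun z : E => ‖z‖) x)) x := by
  rcases eq_or_ne x 0 with rfl | hx
  · have : (0 : ℝ) ^ (p - 1) = 0 := Real.zero_rpow (by linarith)
    simpa [this] using hasFDerivAt_norm_rpow_zero hp
  · have := (h.differentiableAt_norm hx).hasFDerivAt.rpow_const (p := p)
      (Or.inl (norm_ne_zero_iff.2 hx))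
    simpa [smul_smul] using this

lemma UniformlySmooth.dualMapJ_eq (h : UniformlySmooth E) {p : ℝ} (hp : 2 ≤ p) (x : E) :
    dualMapJ p x = ‖x‖ ^ (p - 1) • fderiv ℝ (fun z : E => ‖z‖) x := by
  rw [dualMapJ, (h.hasFDerivAt_norm_rpow hp x).fderiv, smul_smul, inv_mul_cancel₀ (by linarith),
    one_smul]

lemma UniformlySmooth.hasFDerivAt_norm_rpow_dualMapJ (h : UniformlySmooth E) {p : ℝ} (hp : 2 ≤ p)
    (x : E) : HasFDerivAt (fun z : E => ‖z‖ ^ p) (p • dualMapJ p x) x := by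
  rw [h.dualMapJ_eq hp]
  exact h.hasFDerivAt_norm_rpow hp x

lemma UniformlySmooth.dualMapJ_smul (h : UniformlySmooth E) {p : ℝ} (hp : 2 ≤ p) {c : ℝ}
    (hc : 0 < c) (x : E) : dualMapJ p (c • x) = c ^ (p - 1) • dualMapJ p x := by
  rw [h.dualMapJ_eq hp, h.dualMapJ_eq hp, fderiv_norm_smul_pos hc, norm_smul,
    Real.norm_of_nonneg hc.le, Real.mul_rpow hc.le (norm_nonneg _), smul_smul]

lemma UniformlySmooth.dualMapJ_self (h : UniformlySmooth E) {p : ℝ} (hp : 2 ≤ p) (x : E) :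
    dualMapJ p x x = ‖x‖ ^ p := by
  rcases eq_or_ne x 0 with rfl | hx
  · rw [map_zero, norm_zero, Real.zero_rpow (by linarith)]
  · have h0 : 0 < ‖x‖ := norm_pos_iff.2 hx
    rw [h.dualMapJ_eq hp, _root_.smul_apply,
      (h.differentiableAt_norm hx).fderiv_norm_self, smul_eq_mul, Real.rpow_sub_one h0.ne']
    field_simp

lemma UniformlySmooth.abs_dualMapJ_apply_le (h : UniformlySmooth E) {p : ℝ} (hp : 2 ≤ p)
    (x v : E) : |dualMapJ p x v| ≤ ‖x‖ ^ (p - 1) * ‖v‖ := by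
  rw [h.dualMapJ_eq hp, _root_.smul_apply, smul_eq_mul, abs_mul,
    abs_of_nonneg (by positivity : 0 ≤ ‖x‖ ^ (p - 1))]
  gcongr
  have h1 : ‖fderiv ℝ (fun z : E => ‖z‖) x‖ ≤ 1 := by
    simpa using norm_fderiv_le_of_lipschitz ℝ (x₀ := x) (lipschitzWith_one_norm (E := E))
  calc _ ≤ ‖fderiv ℝ (fun z : E => ‖z‖) x‖ * ‖v‖ := ContinuousLinearMap.le_opNorm _ _
    _ ≤ 1 * ‖v‖ := by gcongr
    _ = ‖v‖ := one_mul _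

lemma UniformlySmooth.hasDerivAt_norm_smul_add_rpow (h : UniformlySmooth E) {p : ℝ} (hp : 2 ≤ p)
    (x z : E) (τ : ℝ) :
    HasDerivAt (fun τ : ℝ => ‖τ • x + z‖ ^ p) (p * dualMapJ p (τ • x + z) x) τ := by
  have h1 : HasDerivAt (fun τ : ℝ => τ • x + z) x τ := by
    simpa using ((hasDerivAt_id τ).smul_const x).add_const z
  exact (h.hasFDerivAt_norm_rpow_dualMapJ hp (τ • x + z)).comp_hasDerivAt τ h1

/-- By homogeneity, the integrand `⟨J_p(z/τ + x) - J_p(x), x⟩` is, up to an explicit term, the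
derivative of `τ ↦ ‖τ x + z‖ ^ p`. -/
lemma UniformlySmooth.dualMapJ_inv_smul_add_sub (h : UniformlySmooth E) {p : ℝ} (hp : 2 ≤ p)
    (x z : E) {τ : ℝ} (hτ : 0 < τ) :
    τ ^ (p - 1) * (dualMapJ p (τ⁻¹ • z + x) - dualMapJ p x) x =
      dualMapJ p (τ • x + z) x - τ ^ (p - 1) * ‖x‖ ^ p := by
  have h1 : τ • x + z = τ • (τ⁻¹ • z + x) := by
    rw [smul_add, smul_smul, mul_inv_cancel₀ hτ.ne', one_smul, add_comm]
  rw [h1, h.dualMapJ_smul hp hτ, _root_.sub_apply, h.dualMapJ_self hp,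
    _root_.smul_apply, smul_eq_mul, mul_sub]

end DualMap

section Kernel

variable {E : Type*} [NormedAddCommGroup E] [NormedSpace ℝ E]

/-- The derivative of `τ ↦ ‖τ a + b‖ ^ p - τ ^ p ‖a‖ ^ p`, written with the duality map. -/
def normPowKernel (p : ℝ) (a b : E) (τ : ℝ) : ℝ :=
  p * dualMapJ p (τ • a + b) a - p * τ ^ (p - 1) * ‖a‖ ^ p

lemma UniformlySmooth.normPowKernel_eq (h : UniformlySmooth E) {p : ℝ} (hp : 2 ≤ p)
    (a b : E) {τ : ℝ} (hτ : 0 < τ) :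
    normPowKernel p a b τ =
      p * τ ^ (p - 1) * (dualMapJ p (τ⁻¹ • b + a) - dualMapJ p a) a := by
  rw [mul_assoc, h.dualMapJ_inv_smul_add_sub hp a b hτ, normPowKernel]
  ring

lemma UniformlySmooth.abs_normPowKernel_le (h : UniformlySmooth E) {p : ℝ} (hp : 2 ≤ p)
    {a b : E} {M τ : ℝ} (ha : ‖a‖ ≤ M) (hb : ‖b‖ ≤ M) (hτ : τ ∈ Set.Icc (0 : ℝ) 1) :
    |normPowKernel p a b τ| ≤ p * ((2 * M) ^ (p - 1) * M + M ^ p) := by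
  have hM : 0 ≤ M := (norm_nonneg a).trans ha
  have h0 : ‖τ • a + b‖ ≤ 2 * M := by
    have h1 := norm_add_le (τ • a) b
    rw [norm_smul, Real.norm_of_nonneg hτ.1] at h1
    nlinarith [hτ.2, norm_nonneg a]
  have h1 : |dualMapJ p (τ • a + b) a| ≤ (2 * M) ^ (p - 1) * M :=
    (h.abs_dualMapJ_apply_le hp _ _).trans
      (mul_le_mul (Real.rpow_le_rpow (norm_nonneg _) h0 (by linarith)) ha (norm_nonneg _)
        (by positivity))
  have h2 : |τ ^ (p - 1) * ‖a‖ ^ p| ≤ M ^ p := by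
    have h3 : τ ^ (p - 1) ≤ 1 := Real.rpow_le_one hτ.1 hτ.2 (by linarith)
    have h4 : ‖a‖ ^ p ≤ M ^ p := Real.rpow_le_rpow (norm_nonneg _) ha (by linarith)
    have h5 : 0 ≤ τ ^ (p - 1) := Real.rpow_nonneg hτ.1 _
    rw [abs_of_nonneg (by positivity)]
    calc _ ≤ 1 * ‖a‖ ^ p := by gcongr
      _ ≤ _ := by linarith
  have : normPowKernel p a b τ = p * (dualMapJ p (τ • a + b) a - τ ^ (p - 1) * ‖a‖ ^ p) := by
    rw [normPowKernel]; ring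
  rw [this, abs_mul, abs_of_nonneg (by linarith : 0 ≤ p)]
  exact mul_le_mul_of_nonneg_left ((abs_sub _ _).trans (add_le_add h1 h2)) (by linarith)

lemma UniformlySmooth.hasDerivAt_normPowKernel (h : UniformlySmooth E) {p : ℝ} (hp : 2 ≤ p)
    (a b : E) (τ : ℝ) :
    HasDerivAt (fun τ : ℝ => ‖τ • a + b‖ ^ p - τ ^ p * ‖a‖ ^ p) (normPowKernel p a b τ) τ :=
  (h.hasDerivAt_norm_smul_add_rpow hp a b τ).sub
    ((Real.hasDerivAt_rpow_const (Or.inr (by linarith))).mul_const _)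

lemma UniformlySmooth.measurable_normPowKernel (h : UniformlySmooth E) {p : ℝ} (hp : 2 ≤ p)
    (a b : E) : Measurable (normPowKernel p a b) := by
  have : normPowKernel p a b = deriv (fun τ : ℝ => ‖τ • a + b‖ ^ p - τ ^ p * ‖a‖ ^ p) :=
    funext fun τ => (h.hasDerivAt_normPowKernel hp a b τ).deriv.symm
  rw [this]
  exact measurable_deriv _

lemma UniformlySmooth.integral_normPowKernel (h : UniformlySmooth E) {p : ℝ} (hp : 2 ≤ p)
    (a b : E) :
    ∫ τ in Set.Ioc (0 : ℝ) 1, normPowKernel p a b τ = ‖a + b‖ ^ p - ‖b‖ ^ p - ‖a‖ ^ p := by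
  rw [← intervalIntegral.integral_of_le zero_le_one,
    intervalIntegral.integral_eq_sub_of_hasDerivAt
      (fun τ _ => h.hasDerivAt_normPowKernel hp a b τ)]
  · rw [Real.zero_rpow (by linarith : p ≠ 0)]
    simp only [one_smul, zero_smul, zero_add, Real.one_rpow]
    ring
  · rw [intervalIntegrable_iff_integrableOn_Ioc_of_le zero_le_one]
    refine Measure.integrableOn_of_bounded (by simp)
      (h.measurable_normPowKernel hp a b).aestronglyMeasurable
      (M := p * ((2 * max ‖a‖ ‖b‖) ^ (p - 1) * max ‖a‖ ‖b‖ + max ‖a‖ ‖b‖ ^ p)) ?_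
    refine (ae_restrict_iff' measurableSet_Ioc).2 (Eventually.of_forall fun τ hτ => ?_)
    exact h.abs_normPowKernel_le hp (le_max_left _ _) (le_max_right _ _) ⟨hτ.1.le, hτ.2⟩

variable {α : Type*} [MeasurableSpace α] {μ : Measure α}

lemma UniformlySmooth.aestronglyMeasurable_normPowKernel [SFinite μ] (h : UniformlySmooth E)
    {p : ℝ} (hp : 2 ≤ p) {x z : α → E} (hx : AEStronglyMeasurable x μ)
    (hz : AEStronglyMeasurable z μ) {ν : Measure ℝ} [SFinite ν] :
    AEStronglyMeasurable (fun q : ℝ × α => normPowKernel p (x q.2) (z q.2) q.1) (ν.prod μ) := by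
  have hF : ∀ c : ℝ, AEStronglyMeasurable (fun q : ℝ × α =>
      ‖(q.1 + c) • x q.2 + z q.2‖ ^ p - (q.1 + c) ^ p * ‖x q.2‖ ^ p) (ν.prod μ) := by
    intro c
    have hx' : AEStronglyMeasurable (fun q : ℝ × α => x q.2) (ν.prod μ) := hx.comp_snd
    have hz' : AEStronglyMeasurable (fun q : ℝ × α => z q.2) (ν.prod μ) := hz.comp_snd
    have hτ : AEStronglyMeasurable (fun q : ℝ × α => q.1 + c) (ν.prod μ) := by
      exact (measurable_fst.add_const c).aestronglyMeasurable
    have hpow : Continuous fun s : ℝ => s ^ p := Real.continuous_rpow_const (by linarith)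
    exact (hpow.comp_aestronglyMeasurable ((hτ.smul hx').add hz').norm).sub
      ((hpow.comp_aestronglyMeasurable hτ).mul (hpow.comp_aestronglyMeasurable hx'.norm))
  refine aestronglyMeasurable_of_tendsto_ae atTop
    (f := fun (n : ℕ) (q : ℝ × α) => (1 / ((n : ℝ) + 1))⁻¹ •
      ((‖(q.1 + 1 / ((n : ℝ) + 1)) • x q.2 + z q.2‖ ^ p
          - (q.1 + 1 / ((n : ℝ) + 1)) ^ p * ‖x q.2‖ ^ p)
        - (‖q.1 • x q.2 + z q.2‖ ^ p - q.1 ^ p * ‖x q.2‖ ^ p))) (fun n => ?_)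
    (Eventually.of_forall fun q => ?_)
  · have := (hF (1 / ((n : ℝ) + 1))).sub (hF 0)
    simp only [add_zero] at this
    exact this.const_smul (1 / ((n : ℝ) + 1))⁻¹
  · have h1 := hasDerivAt_iff_tendsto_slope_zero.1
      (h.hasDerivAt_normPowKernel hp (x q.2) (z q.2) q.1)
    refine h1.comp (tendsto_nhdsWithin_iff.2
      ⟨tendsto_one_div_add_atTop_nhds_zero_nat, Eventually.of_forall fun n => ?_⟩)
    have : (0 : ℝ) < 1 / ((n : ℝ) + 1) := Nat.one_div_pos_of_nat
    exact this.ne'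

lemma UniformlySmooth.integrable_normPowKernel_mul [IsFiniteMeasure μ] (h : UniformlySmooth E)
    {p : ℝ} (hp : 2 ≤ p) {x z : α → E} (hx : AEStronglyMeasurable x μ)
    (hz : AEStronglyMeasurable z μ) {M : ℝ} (hxM : ∀ᵐ t ∂μ, ‖x t‖ ≤ M)
    (hzM : ∀ᵐ t ∂μ, ‖z t‖ ≤ M) {φ : α → ℝ} (hφ : Integrable φ μ) :
    Integrable (Function.uncurry fun (τ : ℝ) (t : α) => normPowKernel p (x t) (z t) τ * φ t)
      ((volume.restrict (Set.Ioc (0 : ℝ) 1)).prod μ) := by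
  have hφ' : Integrable (fun q : ℝ × α => φ q.2)
      ((volume.restrict (Set.Ioc (0 : ℝ) 1)).prod μ) := hφ.comp_snd _
  refine hφ'.bdd_mul (c := p * ((2 * M) ^ (p - 1) * M + M ^ p))
    (h.aestronglyMeasurable_normPowKernel hp hx hz) ?_
  have h1 : ∀ᵐ q ∂((volume.restrict (Set.Ioc (0 : ℝ) 1)).prod μ), q.1 ∈ Set.Ioc (0 : ℝ) 1 :=
    Measure.quasiMeasurePreserving_fst.ae (ae_restrict_mem measurableSet_Ioc)
  have h2 : ∀ᵐ q ∂((volume.restrict (Set.Ioc (0 : ℝ) 1)).prod μ), ‖x q.2‖ ≤ M ∧ ‖z q.2‖ ≤ M :=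
    Measure.quasiMeasurePreserving_snd.ae (hxM.and hzM)
  filter_upwards [h1, h2] with q hq1 hq2
  exact h.abs_normPowKernel_le hp hq2.1 hq2.2 ⟨hq1.1.le, hq1.2⟩

lemma UniformlySmooth.integral_norm_rpow_sub_eq [IsFiniteMeasure μ] (h : UniformlySmooth E)
    {p : ℝ} (hp : 2 ≤ p) {x z : α → E} (hx : AEStronglyMeasurable x μ)
    (hz : AEStronglyMeasurable z μ) {M : ℝ} (hxM : ∀ᵐ t ∂μ, ‖x t‖ ≤ M)
    (hzM : ∀ᵐ t ∂μ, ‖z t‖ ≤ M) {φ : α → ℝ} (hφ : Integrable φ μ) :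
    ∫ t, (‖x t + z t‖ ^ p - ‖z t‖ ^ p - ‖x t‖ ^ p) * φ t ∂μ =
      ∫ τ in Set.Ioc (0 : ℝ) 1, ∫ t, normPowKernel p (x t) (z t) τ * φ t ∂μ := by
  rw [integral_integral_swap (h.integrable_normPowKernel_mul hp hx hz hxM hzM hφ)]
  congr with t
  rw [integral_mul_const, h.integral_normPowKernel hp]

/-- The convergence of the integrals built from `J_p` yields that of the integrals of
`‖x + z‖ ^ p - ‖x‖ ^ p`. -/
lemma UniformlySmooth.tendsto_integral_norm_rpow_sub [IsFiniteMeasure μ] (h : UniformlySmooth E)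
    {p : ℝ} (hp : 2 ≤ p) {x : ℕ → α → E} {y z : α → E}
    (hx : ∀ n, AEStronglyMeasurable (x n) μ) (hy : AEStronglyMeasurable y μ)
    (hz : AEStronglyMeasurable z μ) {M : ℝ} (hxM : ∀ n, ∀ᵐ t ∂μ, ‖x n t‖ ≤ M)
    (hyM : ∀ᵐ t ∂μ, ‖y t‖ ≤ M) (hzM : ∀ᵐ t ∂μ, ‖z t‖ ≤ M) {φ : α → ℝ} (hφ : Integrable φ μ)
    (hlim : ∀ c : ℝ, 0 < c → Tendsto (fun n => ∫ t,
        (dualMapJ p (c • z t + x n t) - dualMapJ p (x n t)) (x n t) * φ t ∂μ) atTop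
      (𝓝 (∫ t, (dualMapJ p (c • z t + y t) - dualMapJ p (y t)) (y t) * φ t ∂μ))) :
    Tendsto (fun n => ∫ t, (‖x n t + z t‖ ^ p - ‖z t‖ ^ p - ‖x n t‖ ^ p) * φ t ∂μ) atTop
      (𝓝 (∫ t, (‖y t + z t‖ ^ p - ‖z t‖ ^ p - ‖y t‖ ^ p) * φ t ∂μ)) := by
  have key : ∀ (a : α → E) (τ : ℝ), 0 < τ →
      ∫ t, normPowKernel p (a t) (z t) τ * φ t ∂μ = p * τ ^ (p - 1) *
        ∫ t, (dualMapJ p (τ⁻¹ • z t + a t) - dualMapJ p (a t)) (a t) * φ t ∂μ := by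
    intro a τ hτ
    rw [← integral_const_mul]
    congr with t
    rw [h.normPowKernel_eq hp _ _ hτ]
    ring
  simp_rw [fun n => h.integral_norm_rpow_sub_eq hp (hx n) hz (hxM n) hzM hφ]
  rw [h.integral_norm_rpow_sub_eq hp hy hz hyM hzM hφ]
  refine tendsto_integral_of_dominated_convergence
    (fun _ => ∫ t, p * ((2 * M) ^ (p - 1) * M + M ^ p) * ‖φ t‖ ∂μ)
    (fun n => (h.integrable_normPowKernel_mul hp (hx n) hz (hxM n)
      hzM hφ).integral_prod_left.aestronglyMeasurable) (integrable_const _) (fun n => ?_) ?_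
  · refine (ae_restrict_iff' measurableSet_Ioc).2 (Eventually.of_forall fun τ hτ => ?_)
    refine norm_integral_le_of_norm_le (hφ.norm.const_mul _) ?_
    filter_upwards [hxM n, hzM] with t h1 h2
    rw [norm_mul]
    gcongr
    exact h.abs_normPowKernel_le hp h1 h2 ⟨hτ.1.le, hτ.2⟩
  · refine (ae_restrict_iff' measurableSet_Ioc).2 (Eventually.of_forall fun τ hτ => ?_)
    simp_rw [fun a => key a τ hτ.1]
    exact (hlim τ⁻¹ (inv_pos.2 hτ.1)).const_mul _

end Kernel

section Limit

lemma abs_rpow_sub_rpow_le {p : ℝ} (hp : 1 ≤ p) {R a b : ℝ} (ha : a ∈ Set.Icc 0 R)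
    (hb : b ∈ Set.Icc 0 R) : |a ^ p - b ^ p| ≤ p * R ^ (p - 1) * |a - b| := by
  have hd : ∀ s : ℝ, HasDerivAt (fun s : ℝ => s ^ p) (p * s ^ (p - 1)) s := fun s =>
    Real.hasDerivAt_rpow_const (Or.inr hp)
  refine Convex.norm_image_sub_le_of_norm_deriv_le (f := fun s : ℝ => s ^ p) (s := Set.Icc 0 R)
    (fun s _ => (hd s).differentiableAt) (fun s hs => ?_) (convex_Icc 0 R) hb ha
  rw [(hd s).deriv, Real.norm_of_nonneg
    (mul_nonneg (by linarith) (Real.rpow_nonneg hs.1 _))]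
  exact mul_le_mul_of_nonneg_left (Real.rpow_le_rpow hs.1 hs.2 (by linarith)) (by linarith)

variable {E : Type*} [NormedAddCommGroup E] [NormedSpace ℝ E]
  {α : Type*} [MeasurableSpace α] {μ : Measure α}

lemma UniformlySmooth.ae_norm_le_norm_add_of_tendsto [IsFiniteMeasure μ] (h : UniformlySmooth E)
    {p : ℝ} (hp : 2 ≤ p) {x ζ : ℕ → α → E} {y z : α → E}
    (hx : ∀ n, AEStronglyMeasurable (x n) μ) (hy : AEStronglyMeasurable y μ)
    (hz : AEStronglyMeasurable z μ) (hζ : ∀ n, AEStronglyMeasurable (ζ n) μ)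
    {M : ℝ} (hM : 0 ≤ M) (hxM : ∀ n, ∀ᵐ t ∂μ, ‖x n t‖ ≤ M)
    (hyM : ∀ᵐ t ∂μ, ‖y t‖ ≤ M) (hzM : ∀ᵐ t ∂μ, ‖z t‖ ≤ M) (hζM : ∀ n, ∀ᵐ t ∂μ, ‖ζ n t‖ ≤ M)
    (hζz : ∀ᵐ t ∂μ, Tendsto (fun n => ζ n t) atTop (𝓝 (z t)))
    (hle : ∀ n, ∀ᵐ t ∂μ, ‖x n t‖ ≤ ‖x n t + ζ n t‖)
    (hlim : ∀ c : ℝ, 0 < c → ∀ φ : α → ℝ, Integrable φ μ → Tendsto (fun n => ∫ t,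
        (dualMapJ p (c • z t + x n t) - dualMapJ p (x n t)) (x n t) * φ t ∂μ) atTop
      (𝓝 (∫ t, (dualMapJ p (c • z t + y t) - dualMapJ p (y t)) (y t) * φ t ∂μ))) :
    ∀ᵐ t ∂μ, ‖y t‖ ≤ ‖y t + z t‖ := by
  have hp0 : 0 ≤ p := by linarith
  have hpow : Continuous fun s : ℝ => s ^ p := Real.continuous_rpow_const hp0
  have hint : ∀ (a : α → E), AEStronglyMeasurable a μ → (∀ᵐ t ∂μ, ‖a t‖ ≤ M + M) →
      Integrable (fun t => ‖a t‖ ^ p) μ := by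
    intro a ha haM
    refine Integrable.of_bound (hpow.comp_aestronglyMeasurable ha.norm) ((M + M) ^ p) ?_
    filter_upwards [haM] with t ht
    rw [Real.norm_of_nonneg (by positivity)]
    exact Real.rpow_le_rpow (norm_nonneg _) ht hp0
  have hadd : ∀ {a b : α → E}, (∀ᵐ t ∂μ, ‖a t‖ ≤ M) → (∀ᵐ t ∂μ, ‖b t‖ ≤ M) →
      ∀ᵐ t ∂μ, ‖a t + b t‖ ≤ M + M := by
    intro a b ha hb
    filter_upwards [ha, hb] with t h1 h2 using (norm_add_le _ _).trans (add_le_add h1 h2)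
  have hw : ∀ {a : α → E}, (∀ᵐ t ∂μ, ‖a t‖ ≤ M) → ∀ᵐ t ∂μ, ‖a t‖ ≤ M + M := by
    intro a ha
    filter_upwards [ha] with t h1 using by linarith
  have hyz := hint _ (hy.add hz) (hadd hyM hzM)
  have hyi := hint _ hy (hw hyM)
  have hzi := hint _ hz (hw hzM)
  have hnonneg : 0 ≤ᵐ[μ] fun t => ‖y t + z t‖ ^ p - ‖y t‖ ^ p := by
    refine ae_nonneg_of_forall_setIntegral_nonneg (hyz.sub hyi) fun A hA _ => ?_
    have hφ : Integrable (fun t => A.indicator (fun _ => (1 : ℝ)) t) μ :=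
      (integrable_const (1 : ℝ)).indicator hA
    have hφA : ∀ F : α → ℝ, ∫ t, F t * A.indicator (fun _ => (1 : ℝ)) t ∂μ = ∫ t in A, F t ∂μ := by
      intro F
      rw [← integral_indicator hA]
      congr with t
      by_cases ht : t ∈ A <;> simp [ht]
    have h1 := h.tendsto_integral_norm_rpow_sub hp hx hy hz hxM hyM hzM hφ
      (fun c hc => hlim c hc _ hφ)
    simp_rw [hφA] at h1
    have h2 : Tendsto (fun n => ∫ t in A, (‖x n t + z t‖ ^ p - ‖x n t + ζ n t‖ ^ p - ‖z t‖ ^ p) ∂μ)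
        atTop (𝓝 (∫ t in A, (0 - ‖z t‖ ^ p) ∂μ)) := by
      refine tendsto_integral_of_dominated_convergence
        (fun _ => (M + M) ^ p + (M + M) ^ p + (M + M) ^ p)
        (fun n => ?_) (integrable_const _) (fun n => ?_) ?_
      · exact ((((hint _ ((hx n).add hz) (hadd (hxM n) hzM)).sub
          (hint _ ((hx n).add (hζ n)) (hadd (hxM n) (hζM n)))).sub hzi).restrict
          (s := A)).aestronglyMeasurable
      · refine ae_restrict_of_ae ?_
        have hb : ∀ v : E, ‖v‖ ≤ M + M → |‖v‖ ^ p| ≤ (M + M) ^ p := fun v hv => by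
          rw [abs_of_nonneg (by positivity)]
          exact Real.rpow_le_rpow (norm_nonneg _) hv hp0
        filter_upwards [hadd (hxM n) hzM, hadd (hxM n) (hζM n), hw hzM] with t h3 h4 h5
        exact (abs_sub _ _).trans (add_le_add ((abs_sub _ _).trans
          (add_le_add (hb _ h3) (hb _ h4))) (hb _ h5))
      · refine ae_restrict_of_ae ?_
        have hall := ae_all_iff.2 fun n => (hadd (hxM n) hzM).and (hadd (hxM n) (hζM n))
        filter_upwards [hall, hζz] with t ht htz
        refine Tendsto.sub ?_ tendsto_const_nhds
        refine squeeze_zero_norm (a := fun n => p * (M + M) ^ (p - 1) * ‖ζ n t - z t‖)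
          (fun n => ?_) ?_
        · refine (abs_rpow_sub_rpow_le (by linarith) ⟨norm_nonneg _, (ht n).1⟩
            ⟨norm_nonneg _, (ht n).2⟩).trans ?_
          refine mul_le_mul_of_nonneg_left ((abs_norm_sub_norm_le _ _).trans (le_of_eq ?_))
            (by positivity)
          rw [norm_sub_rev]
          congr 1
          abel
        · have := (tendsto_iff_norm_sub_tendsto_zero.1 htz).const_mul (p * (M + M) ^ (p - 1))
          simpa using this
    have h3 : ∫ t in A, (0 - ‖z t‖ ^ p) ∂μ ≤
        ∫ t in A, (‖y t + z t‖ ^ p - ‖z t‖ ^ p - ‖y t‖ ^ p) ∂μ := by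
      refine le_of_tendsto_of_tendsto' h2 h1 fun n => ?_
      have hxz := hint _ ((hx n).add hz) (hadd (hxM n) hzM)
      refine integral_mono_ae
        (((hxz.sub (hint _ ((hx n).add (hζ n)) (hadd (hxM n) (hζM n)))).sub hzi).restrict)
        (((hxz.sub hzi).sub (hint _ (hx n) (hw (hxM n)))).restrict) (ae_restrict_of_ae ?_)
      filter_upwards [hle n] with t ht
      have := Real.rpow_le_rpow (norm_nonneg _) ht hp0
      change _ - _ - _ ≤ _ - _ - _
      linarith
    have h4 : ∫ t in A, (‖y t + z t‖ ^ p - ‖z t‖ ^ p - ‖y t‖ ^ p) ∂μ =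
        ∫ t in A, (‖y t + z t‖ ^ p - ‖y t‖ ^ p) ∂μ + ∫ t in A, (0 - ‖z t‖ ^ p) ∂μ := by
      have hFi : Integrable (fun t => ‖y t + z t‖ ^ p - ‖y t‖ ^ p) μ := hyz.sub hyi
      have hzn : Integrable (fun t => 0 - ‖z t‖ ^ p) μ := (integrable_zero _ _ _).sub hzi
      rw [← integral_add hFi.restrict hzn.restrict]
      congr with t
      ring
    linarith
  filter_upwards [hnonneg] with t ht
  exact (Real.rpow_le_rpow_iff (norm_nonneg _) (norm_nonneg _) (by linarith)).1
    (sub_nonneg.1 ht)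

end Limit

section Scheme

variable {E : Type*} [NormedAddCommGroup E] [NormedSpace ℝ E]

/-- One step of the explicit catching-up scheme. -/
lemma DirProxRegular.exists_step {r : ℝ} {f : E → E} {C : Set E} (hC : DirProxRegular r f C)
    {u : E} (hu : u ∈ C) {h : ℝ} (hh : 0 < h) (hlt : h * ‖f u‖ < r) :
    ∃ v : E, u + h • (f u - v) ∈ C ∧ ‖v‖ ≤ ‖f u‖ ∧ ∀ s : ℝ, 0 ≤ s → s * ‖v‖ ≤ r → ∀ w ∈ C,
      ‖s • v‖ ≤ ‖s • v + (u + h • (f u - v) - w)‖ := by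
  rcases eq_or_ne (f u) 0 with h0 | h0
  · exact ⟨0, by simpa [h0] using hu, by simp, by simp⟩
  have hf : 0 < ‖f u‖ := norm_pos_iff.2 h0
  obtain ⟨z, hz, hΓ⟩ := hC u hu (h * ‖f u‖) (by positivity) hlt
  rw [mul_assoc, mul_inv_cancel₀ hf.ne', mul_one] at hz hΓ
  obtain ⟨hzC, hzd⟩ : z ∈ projSet C (u + h • f u) := hz ▸ rfl
  set d := u + h • f u - z with hd
  have hhv : h • (h⁻¹ • d) = d := by rw [smul_smul, mul_inv_cancel₀ hh.ne', one_smul]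
  have hstep : u + h • (f u - h⁻¹ • d) = z := by
    rw [smul_sub, hhv, hd]; abel
  have hdle : ‖d‖ ≤ h * ‖f u‖ := by
    rw [hzd]
    refine (Metric.infDist_le_dist_of_mem hu).trans (le_of_eq ?_)
    rw [dist_eq_norm, add_sub_cancel_left, norm_smul, Real.norm_of_nonneg hh.le]
  refine ⟨h⁻¹ • d, hstep ▸ hzC, ?_, fun s hs hsr w hw => ?_⟩
  · rw [norm_smul, Real.norm_of_nonneg (by positivity), inv_mul_le_iff₀ hh]
    exact hdle
  rw [hstep]
  rcases eq_or_ne d 0 with hd0 | hd0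
  · simp [hd0]
  have hdpos : 0 < ‖d‖ := norm_pos_iff.2 hd0
  set e := ‖d‖⁻¹ • d with he
  have hen : ‖e‖ = 1 := by
    rw [he, norm_smul, norm_inv, norm_norm, inv_mul_cancel₀ hdpos.ne']
  have hr : 0 < r := lt_of_le_of_lt (by positivity) hlt
  have h1 : r ≤ ‖z + r • e - w‖ := by
    have h2 := hΓ.2
    rw [add_sub_cancel_left, norm_smul, hen, mul_one, Real.norm_of_nonneg hr.le] at h2
    rw [← dist_eq_norm]
    exact h2.le.trans (Metric.infDist_le_dist_of_mem hw)
  set τ := s * ‖h⁻¹ • d‖ with hτ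
  have hτ0 : 0 ≤ τ := by positivity
  have hse : s • (h⁻¹ • d) = τ • e := by
    rw [hτ, he, norm_smul, Real.norm_of_nonneg (by positivity), smul_smul, smul_smul]
    congr 1
    field_simp
  rw [hse, norm_smul, hen, mul_one, Real.norm_of_nonneg hτ0]
  have h3 : z + r • e - w = (τ • e + (z - w)) + (r - τ) • e := by
    rw [sub_smul]; abel
  have h4 : ‖(r - τ) • e‖ = r - τ := by
    rw [norm_smul, hen, mul_one, Real.norm_of_nonneg (by linarith)]
  have h5 := norm_add_le (τ • e + (z - w)) ((r - τ) • e)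
  rw [← h3, h4] at h5
  linarith

/-- The explicit catching-up scheme with step `h`, together with its a priori bounds. -/
lemma DirProxRegular.exists_scheme {r : ℝ} {f : E → E} {C : Set E} (hC : DirProxRegular r f C)
    (hr : 0 < r) {L : ℝ} (hL : 0 < L) (hf : ∀ x, ‖f x‖ ≤ L * (1 + ‖x‖)) {u₀ : E} (hu₀ : u₀ ∈ C)
    {T R h : ℝ} (hR : Real.exp (2 * L * T) * (1 + ‖u₀‖) ≤ R) (hh : 0 < h) (hhr : h * (L * R) < r) :
    ∃ U V : ℕ → E, U 0 = u₀ ∧ (∀ k, U (k + 1) = U k + h • (f (U k) - V k)) ∧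
      ∀ k : ℕ, k * h ≤ T → U k ∈ C ∧ U (k + 1) ∈ C ∧ ‖U k‖ ≤ R ∧ ‖f (U k)‖ ≤ L * R ∧
        ‖V k‖ ≤ L * R ∧ ∀ w ∈ C, ‖V k‖ ≤ ‖V k + (L * R / r) • (U (k + 1) - w)‖ := by
  have hstep : ∀ u : E, ∃ v : E, u ∈ C → h * ‖f u‖ < r → u + h • (f u - v) ∈ C ∧ ‖v‖ ≤ ‖f u‖ ∧
      ∀ s : ℝ, 0 ≤ s → s * ‖v‖ ≤ r → ∀ w ∈ C, ‖s • v‖ ≤ ‖s • v + (u + h • (f u - v) - w)‖ := by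
    intro u
    by_cases hu : u ∈ C ∧ h * ‖f u‖ < r
    · obtain ⟨v, hv⟩ := hC.exists_step hu.1 hh hu.2
      exact ⟨v, fun _ _ => hv⟩
    · exact ⟨0, fun h1 h2 => absurd ⟨h1, h2⟩ hu⟩
  choose W hW using hstep
  let U : ℕ → E := fun n => Nat.rec u₀ (fun _ u => u + h • (f u - W u)) n
  have hU : ∀ k, U (k + 1) = U k + h • (f (U k) - W (U k)) := fun _ => rfl
  have hR0 : 0 < R := lt_of_lt_of_le (by positivity) hR
  have hbound : ∀ u : E, 1 + ‖u‖ ≤ R → ‖f u‖ ≤ L * R := fun u hu =>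
    (hf u).trans (mul_le_mul_of_nonneg_left hu hL.le)
  have hsmall : ∀ u : E, 1 + ‖u‖ ≤ R → h * ‖f u‖ < r := fun u hu =>
    (mul_le_mul_of_nonneg_left (hbound u hu) hh.le).trans_lt hhr
  have hexp : ∀ k : ℕ, k * h ≤ T → Real.exp (2 * L * (k * h)) * (1 + ‖u₀‖) ≤ R := by
    intro k hk
    refine le_trans ?_ hR
    gcongr
  have main : ∀ k : ℕ, k * h ≤ T →
      U k ∈ C ∧ 1 + ‖U k‖ ≤ Real.exp (2 * L * (k * h)) * (1 + ‖u₀‖) := by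
    intro k
    induction k with
    | zero => intro _; exact ⟨hu₀, by simp [U]⟩
    | succ k ih =>
      intro hk
      push_cast at hk
      have hk' : k * h ≤ T := by nlinarith
      obtain ⟨h1, h2⟩ := ih hk'
      have h3 := h2.trans (hexp k hk')
      obtain ⟨h4, h5, -⟩ := hW (U k) h1 (hsmall _ h3)
      refine ⟨h4, ?_⟩
      have h6 : ‖U (k + 1)‖ ≤ ‖U k‖ + h * (2 * (L * (1 + ‖U k‖))) := by
        rw [hU]
        refine (norm_add_le _ _).trans ?_
        rw [norm_smul, Real.norm_of_nonneg hh.le]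
        have := norm_sub_le (f (U k)) (W (U k))
        have := hf (U k)
        gcongr
        linarith
      calc 1 + ‖U (k + 1)‖ ≤ (2 * L * h + 1) * (1 + ‖U k‖) := by linarith
        _ ≤ Real.exp (2 * L * h) * (Real.exp (2 * L * (k * h)) * (1 + ‖u₀‖)) := by
          gcongr
          exact Real.add_one_le_exp _
        _ = Real.exp (2 * L * ((k + 1 : ℕ) * h)) * (1 + ‖u₀‖) := by
          rw [← mul_assoc, ← Real.exp_add]
          congr 2
          push_cast
          ring
  refine ⟨U, fun k => W (U k), rfl, hU, fun k hk => ?_⟩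
  obtain ⟨h1, h2⟩ := main k hk
  have h3 := h2.trans (hexp k hk)
  obtain ⟨h4, h5, h6⟩ := hW (U k) h1 (hsmall _ h3)
  have h7 := h5.trans (hbound _ h3)
  refine ⟨h1, h4, by linarith, hbound _ h3, h7, fun w hw => ?_⟩
  have hLR : 0 < L * R := by positivity
  have hs : 0 < r / (L * R) := by positivity
  have h8 := h6 (r / (L * R)) hs.le
    (by rw [div_mul_eq_mul_div, div_le_iff₀ hLR]; gcongr) w hw
  have h9 : (r / (L * R)) • W (U k) + (U k + h • (f (U k) - W (U k)) - w) =
      (r / (L * R)) • (W (U k) + (L * R / r) • (U (k + 1) - w)) := by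
    rw [smul_add, smul_smul, div_mul_div_comm, mul_comm r, div_self (by positivity), one_smul, hU]
  rw [h9, norm_smul, norm_smul] at h8
  exact le_of_mul_le_mul_left h8 (norm_pos_iff.2 hs.ne')

lemma intervalIntegral_comp_floor_div [CompleteSpace E] {G : ℕ → E} {h : ℝ} (hh : 0 < h) (k : ℕ) {t : ℝ}
    (ht : t ∈ Set.Icc (k * h) ((k + 1) * h)) :
    IntervalIntegrable (fun s => G ⌊s / h⌋₊) volume (k * h) t ∧
      ∫ s in (k * h)..t, G ⌊s / h⌋₊ = (t - k * h) • G k := by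
  have hae : ∀ᵐ s : ℝ, s ∈ Set.uIoc (k * h) t → G ⌊s / h⌋₊ = G k := by
    filter_upwards [(Set.countable_singleton ((k + 1) * h)).ae_notMem volume] with s hs hsI
    rw [Set.uIoc_of_le ht.1] at hsI
    congr 1
    have hlt : s < (k + 1) * h := lt_of_le_of_ne (hsI.2.trans ht.2) (by simpa using hs)
    have hs0 : 0 ≤ s := le_trans (by positivity) hsI.1.le
    rw [Nat.floor_eq_iff (by positivity), le_div_iff₀ hh, div_lt_iff₀ hh]
    exact ⟨hsI.1.le, hlt⟩
  constructor
  · refine (intervalIntegrable_const (c := G k)).congr_ae ?_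
    rw [EventuallyEq, ae_restrict_iff' measurableSet_uIoc]
    filter_upwards [hae] with s hs hsI using (hs hsI).symm
  · rw [intervalIntegral.integral_congr_ae hae]
    exact intervalIntegral.integral_const _

/-- An explicit Euler scheme is the integral of its piecewise constant velocity, at the nodes. -/
lemma intervalIntegral_comp_floor_div_eq_sub [CompleteSpace E] {U G : ℕ → E} {h : ℝ} (hh : 0 < h)
    (hU : ∀ k, U (k + 1) = U k + h • G k) (k : ℕ) :
    IntervalIntegrable (fun s => G ⌊s / h⌋₊) volume 0 (k * h) ∧
      ∫ s in (0 : ℝ)..(k * h), G ⌊s / h⌋₊ = U k - U 0 := by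
  induction k with
  | zero => simp
  | succ k ih =>
    obtain ⟨h1, h2⟩ := intervalIntegral_comp_floor_div (G := G) hh k (t := (k + 1) * h)
      ⟨by nlinarith, le_rfl⟩
    push_cast
    refine ⟨ih.1.trans h1, ?_⟩
    rw [← intervalIntegral.integral_add_adjacent_intervals ih.1 h1, ih.2, h2, hU,
      show ((k : ℝ) + 1) * h - k * h = h by ring]
    abel

lemma floor_div_mul_le {h t : ℝ} (hh : 0 < h) (ht : 0 ≤ t) : (⌊t / h⌋₊ : ℝ) * h ≤ t :=
  (le_div_iff₀ hh).1 (Nat.floor_le (by positivity))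

lemma lt_floor_div_add_one_mul {h : ℝ} (hh : 0 < h) (t : ℝ) : t < ((⌊t / h⌋₊ : ℝ) + 1) * h :=
  (div_lt_iff₀ hh).1 (Nat.lt_floor_add_one _)

/-- Piecewise constant approximate solutions of the sweeping process. -/
lemma DirProxRegular.exists_approx [CompleteSpace E] {r : ℝ} {f : E → E} {C : Set E}
    (hC : DirProxRegular r f C)
    (hr : 0 < r) {L : ℝ} (hL : 0 < L) (hf : ∀ x, ‖f x‖ ≤ L * (1 + ‖x‖)) {u₀ : E} (hu₀ : u₀ ∈ C)
    {T R h : ℝ} (hR : Real.exp (2 * L * T) * (1 + ‖u₀‖) ≤ R) (hh : 0 < h) (hhr : h * (L * R) < r) :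
    ∃ a b x : ℝ → E, StronglyMeasurable a ∧ StronglyMeasurable b ∧ StronglyMeasurable x ∧
      ∀ t ∈ Set.Icc 0 T, a t ∈ C ∧ b t ∈ C ∧ ‖a t‖ ≤ R ∧ ‖f (a t)‖ ≤ L * R ∧ ‖x t‖ ≤ L * R ∧
        ‖b t - a t‖ ≤ 2 * (L * R) * h ∧
        (∀ w ∈ C, ‖x t‖ ≤ ‖x t + (L * R / r) • (b t - w)‖) ∧
        (∀ s ∈ Set.Icc 0 T, ‖a t - a s‖ ≤ 2 * (L * R) * (|t - s| + h)) ∧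
        ‖a t - u₀ - ∫ s in (0 : ℝ)..t, (f (a s) - x s)‖ ≤ 2 * (L * R) * h := by
  obtain ⟨U, V, hU0, hU, hUV⟩ := hC.exists_scheme hr hL hf hu₀ hR hh hhr
  have hmeas : ∀ F : ℕ → E, StronglyMeasurable fun t : ℝ => F ⌊t / h⌋₊ := fun F =>
    StronglyMeasurable.of_discrete.comp_measurable
      (Nat.measurable_floor.comp (measurable_id.div_const h))
  have hR0 : 0 < R := lt_of_lt_of_le (by positivity) hR
  have hfl : ∀ t ∈ Set.Icc 0 T, (⌊t / h⌋₊ : ℝ) * h ≤ T := fun t ht =>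
    (floor_div_mul_le hh ht.1).trans ht.2
  have hG : ∀ k : ℕ, k * h ≤ T → ‖f (U k) - V k‖ ≤ 2 * (L * R) := fun k hk => by
    obtain ⟨-, -, -, h1, h2, -⟩ := hUV k hk
    exact (norm_sub_le _ _).trans (by linarith)
  have hlip : ∀ i j : ℕ, ((i + j : ℕ) : ℝ) * h ≤ T → ‖U (i + j) - U i‖ ≤ 2 * (L * R) * (j * h) := by
    intro i j
    induction j with
    | zero => simp
    | succ j ih =>
      intro hj
      push_cast at hj
      have hj' : ((i + j : ℕ) : ℝ) * h ≤ T := by push_cast; nlinarith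
      have h1 : U (i + (j + 1)) - U i = (U (i + j) - U i) + h • (f (U (i + j)) - V (i + j)) := by
        rw [← add_assoc, hU]; abel
      rw [h1]
      refine (norm_add_le _ _).trans ?_
      rw [norm_smul, Real.norm_of_nonneg hh.le]
      have h2 := mul_le_mul_of_nonneg_left (hG _ hj') hh.le
      have h3 := ih hj'
      push_cast
      linarith
  have hlip' : ∀ t ∈ Set.Icc 0 T, ∀ s ∈ Set.Icc 0 T, s ≤ t →
      ‖U ⌊t / h⌋₊ - U ⌊s / h⌋₊‖ ≤ 2 * (L * R) * (|t - s| + h) := by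
    intro t ht s hs hst
    obtain ⟨j, hj⟩ := Nat.exists_eq_add_of_le (Nat.floor_mono (div_le_div_of_nonneg_right hst hh.le))
    have h1 := hfl t ht
    rw [hj] at h1 ⊢
    refine (hlip _ _ h1).trans (mul_le_mul_of_nonneg_left ?_ (by positivity))
    have h2 := floor_div_mul_le hh ht.1
    have h3 := lt_floor_div_add_one_mul hh s
    rw [hj] at h2
    push_cast at h2
    rw [abs_of_nonneg (by linarith)]
    linarith
  refine ⟨fun t => U ⌊t / h⌋₊, fun t => U (⌊t / h⌋₊ + 1), fun t => V ⌊t / h⌋₊, hmeas U,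
    hmeas fun k => U (k + 1), hmeas V, fun t ht => ?_⟩
  obtain ⟨h1, h2, h3, h4, h5, h6⟩ := hUV _ (hfl t ht)
  refine ⟨h1, h2, h3, h4, h5, ?_, h6, fun s hs => ?_, ?_⟩
  · beta_reduce
    rw [hU, add_sub_cancel_left, norm_smul, Real.norm_of_nonneg hh.le, mul_comm]
    exact mul_le_mul_of_nonneg_right (hG _ (hfl t ht)) hh.le
  · rcases le_total s t with hst | hst
    · exact hlip' t ht s hs hst
    · rw [norm_sub_rev, abs_sub_comm]
      exact hlip' s hs t ht hst
  · have h7 := intervalIntegral_comp_floor_div_eq_sub (G := fun k => f (U k) - V k) hh hU ⌊t / h⌋₊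
    have h8 := floor_div_mul_le hh ht.1
    have h9 := lt_floor_div_add_one_mul hh t
    have h10 := intervalIntegral_comp_floor_div (G := fun k => f (U k) - V k) hh ⌊t / h⌋₊ (t := t)
      ⟨h8, h9.le⟩
    rw [← intervalIntegral.integral_add_adjacent_intervals h7.1 h10.1, h7.2, h10.2, hU0,
      sub_add_eq_sub_sub, sub_self, zero_sub, norm_neg, norm_smul, Real.norm_of_nonneg (by linarith),
      mul_comm]
    exact mul_le_mul (hG _ (hfl t ht)) (by linarith) (by linarith) (by positivity)

end Scheme

/-- A version of the Arzelà–Ascoli theorem for asymptotically equi-Lipschitz functions which need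
not be continuous. -/
lemma exists_subseq_tendsto_of_norm_sub_le {E : Type*} [NormedAddCommGroup E] [CompleteSpace E]
    {K : Set E} (hK : IsCompact K) {T : ℝ} (hT : 0 ≤ T) {a : ℕ → ℝ → E}
    (haK : ∀ n, ∀ t ∈ Set.Icc 0 T, a n t ∈ K) {D : ℝ} (hD : 0 ≤ D) {ε : ℕ → ℝ}
    (hε : Tendsto ε atTop (𝓝 0))
    (ha : ∀ n, ∀ t ∈ Set.Icc 0 T, ∀ s ∈ Set.Icc 0 T, ‖a n t - a n s‖ ≤ D * (|t - s| + ε n)) :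
    ∃ κ : ℕ → ℕ, StrictMono κ ∧ ∃ u : ℝ → E, ∀ t ∈ Set.Icc 0 T,
      Tendsto (fun n => a (κ n) t) atTop (𝓝 (u t)) := by
  let π : ℝ → ℝ := fun q => max 0 (min q T)
  have hπ : ∀ q, π q ∈ Set.Icc 0 T := fun q => ⟨le_max_left _ _, max_le hT (min_le_right _ _)⟩
  have hπt : ∀ t ∈ Set.Icc 0 T, ∀ q, |t - π q| ≤ |t - q| := by
    intro t ht q
    have : π t = t := by simp only [π]; rw [min_eq_left ht.2, max_eq_right ht.1]
    calc |t - π q| = |π t - π q| := by rw [this]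
      _ ≤ |min t T - min q T| := by
        simpa using abs_max_sub_max_le_max 0 (min t T) 0 (min q T)
      _ ≤ |t - q| := by simpa using abs_min_sub_min_le_max t T q T
  obtain ⟨v, -, κ, hκ, hv⟩ := (isCompact_univ_pi fun _ : ℚ => hK).tendsto_subseq
    (x := fun n (q : ℚ) => a n (π q)) (fun n q _ => haK n _ (hπ q))
  have hlim : ∀ t ∈ Set.Icc 0 T, ∃ w, Tendsto (fun n => a (κ n) t) atTop (𝓝 w) := by
    intro t ht
    refine cauchySeq_tendsto_of_complete (Metric.cauchySeq_iff.2 fun η hη => ?_)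
    set δ := η / (8 * (D + 1)) with hδ
    have hδ0 : 0 < δ := by positivity
    obtain ⟨q, hq1, hq2⟩ := exists_rat_btwn (show t < t + δ by linarith)
    have htq : |t - π q| ≤ δ := (hπt t ht q).trans (by rw [abs_le]; constructor <;> linarith)
    have hc := Metric.cauchySeq_iff.1 ((tendsto_pi_nhds.1 hv q).cauchySeq) (η / 4) (by positivity)
    obtain ⟨N₁, hN₁⟩ := hc
    obtain ⟨N₂, hN₂⟩ := eventually_atTop.1
      ((hε.comp hκ.tendsto_atTop).eventually (gt_mem_nhds hδ0))
    have hclose : ∀ n ≥ N₂, dist (a (κ n) t) (a (κ n) (π q)) ≤ η / 4 := by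
      intro n hn
      rw [dist_eq_norm]
      refine (ha _ t ht _ (hπ q)).trans ?_
      have h1 : ε (κ n) < δ := hN₂ n hn
      have h2 : D * (|t - π q| + ε (κ n)) ≤ (D + 1) * (2 * δ) := by
        refine (mul_le_mul_of_nonneg_left (show _ ≤ 2 * δ by linarith) hD).trans ?_
        nlinarith
      refine h2.trans (le_of_eq ?_)
      rw [hδ]
      field_simp
      norm_num
    refine ⟨max N₁ N₂, fun m hm n hn => ?_⟩
    have h1 := hclose m (le_of_max_le_right hm)
    have h2 := hclose n (le_of_max_le_right hn)
    have h3 : dist (a (κ m) (π q)) (a (κ n) (π q)) < η / 4 :=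
      hN₁ m (le_of_max_le_left hm) n (le_of_max_le_left hn)
    have h4 := dist_triangle4 (a (κ m) t) (a (κ m) (π q)) (a (κ n) (π q)) (a (κ n) t)
    rw [dist_comm (a (κ n) (π q))] at h4
    linarith
  choose! u hu using hlim
  exact ⟨κ, hκ, u, hu⟩

lemma mem_proxNormalCone_of_norm_le {E : Type*} [NormedAddCommGroup E] [NormedSpace ℝ E]
    {C : Set E} {x v : E} (hx : x ∈ C) {s : ℝ} (hs : 0 < s)
    (h : ∀ w ∈ C, ‖v‖ ≤ ‖v + s⁻¹ • (x - w)‖) : v ∈ proxNormalCone C x := by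
  refine ⟨s, hs, hx, le_antisymm ((Metric.le_infDist ⟨x, hx⟩).2 fun {w} hw => ?_) ?_⟩
  · have h1 : x + s • v - w = s • (v + s⁻¹ • (x - w)) := by
      rw [smul_add, smul_smul, mul_inv_cancel₀ hs.ne', one_smul]; abel
    rw [add_sub_cancel_left, dist_eq_norm, h1, norm_smul, norm_smul]
    exact mul_le_mul_of_nonneg_left (h w hw) (norm_nonneg _)
  · rw [← dist_eq_norm]
    exact Metric.infDist_le_dist_of_mem hx

/-- The integral equation passes to the limit when the velocities converge only weakly. -/
lemma eq_add_integral_of_tendsto {E : Type*} [NormedAddCommGroup E] [NormedSpace ℝ E]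
    [CompleteSpace E] {T : ℝ} {a F x : ℕ → ℝ → E} {u G y : ℝ → E} {u₀ : E} {M : ℝ}
    (hF : ∀ n, AEStronglyMeasurable (F n) (volume.restrict (Set.Icc 0 T)))
    (hFM : ∀ n, ∀ t ∈ Set.Icc 0 T, ‖F n t‖ ≤ M)
    (hFG : ∀ t ∈ Set.Icc 0 T, Tendsto (fun n => F n t) atTop (𝓝 (G t)))
    (hx : ∀ n, IntegrableOn (x n) (Set.Icc 0 T)) (hG : IntegrableOn G (Set.Icc 0 T))
    (hy : IntegrableOn y (Set.Icc 0 T))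
    (hxy : ∀ g : ℝ → (E →L[ℝ] ℝ), Integrable g (volume.restrict (Set.Icc 0 T)) →
        Tendsto (fun n => ∫ t, g t (x n t) ∂volume.restrict (Set.Icc 0 T)) atTop
          (𝓝 (∫ t, g t (y t) ∂volume.restrict (Set.Icc 0 T))))
    {t : ℝ} (ht : t ∈ Set.Icc 0 T) (hau : Tendsto (fun n => a n t) atTop (𝓝 (u t)))
    (ha : Tendsto (fun n => ‖a n t - u₀ - ∫ s in (0 : ℝ)..t, (F n s - x n s)‖) atTop (𝓝 0)) :
    u t = u₀ + ∫ s in (0 : ℝ)..t, (G s - y s) := by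
  have hsub : Set.Ioc 0 t ⊆ Set.Icc 0 T := fun s hs => ⟨hs.1.le, hs.2.trans ht.2⟩
  have hint : ∀ {P Q : ℝ → E}, IntegrableOn P (Set.Icc 0 T) → IntegrableOn Q (Set.Icc 0 T) →
      ∫ s in (0 : ℝ)..t, (P s - Q s) = (∫ s in Set.Ioc 0 t, P s) - ∫ s in Set.Ioc 0 t, Q s := by
    intro P Q hP hQ
    rw [intervalIntegral.integral_of_le ht.1]
    exact integral_sub (hP.mono_set hsub) (hQ.mono_set hsub)
  have hFi : ∀ n, IntegrableOn (F n) (Set.Icc 0 T) := fun n =>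
    Integrable.of_bound (hF n) M
      ((ae_restrict_iff' measurableSet_Icc).2 (Eventually.of_forall (hFM n)))
  have hFlim : Tendsto (fun n => ∫ s in Set.Ioc 0 t, F n s) atTop
      (𝓝 (∫ s in Set.Ioc 0 t, G s)) := by
    refine tendsto_integral_of_dominated_convergence (fun _ => M)
      (fun n => (hF n).mono_measure (Measure.restrict_mono hsub le_rfl)) (integrable_const _)
      (fun n => ?_) ?_
    · exact (ae_restrict_iff' measurableSet_Ioc).2
        (Eventually.of_forall fun s hs => hFM n s (hsub hs))
    · exact (ae_restrict_iff' measurableSet_Ioc).2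
        (Eventually.of_forall fun s hs => hFG s (hsub hs))
  rw [hint hG hy]
  refine (SeparatingDual.eq_iff_forall_dual_eq (R := ℝ)).2 fun l => ?_
  have hl : ∀ {P : ℝ → E}, IntegrableOn P (Set.Icc 0 T) →
      ∫ s, (Set.Ioc 0 t).indicator (fun _ => l) s (P s) ∂volume.restrict (Set.Icc 0 T) =
        l (∫ s in Set.Ioc 0 t, P s) := by
    intro P hP
    rw [← l.integral_comp_comm (hP.mono_set hsub)]
    have : ∀ s, (Set.Ioc 0 t).indicator (fun _ => l) s (P s) =
        (Set.Ioc 0 t).indicator (fun s => l (P s)) s := by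
      intro s
      by_cases hs : s ∈ Set.Ioc 0 t <;> simp [hs]
    simp_rw [this]
    rw [integral_indicator measurableSet_Ioc, Measure.restrict_restrict measurableSet_Ioc,
      Set.inter_eq_left.2 hsub]
  have hxlim := hxy ((Set.Ioc 0 t).indicator fun _ => l)
    ((integrable_const l).indicator measurableSet_Ioc)
  rw [hl hy] at hxlim
  simp_rw [fun n => hl (hx n)] at hxlim
  have h1 : Tendsto (fun n => l (a n t - u₀ - ∫ s in (0 : ℝ)..t, (F n s - x n s))) atTop (𝓝 0) := by
    have h := (l.continuous.tendsto 0).comp (tendsto_zero_iff_norm_tendsto_zero.2 ha)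
    rw [map_zero] at h
    exact h
  simp_rw [fun n => hint (hFi n) (hx n), map_sub] at h1
  have h2 := (((l.continuous.tendsto _).comp hau).sub_const (l u₀)).sub
    (((l.continuous.tendsto _).comp hFlim).sub hxlim)
  have h3 := tendsto_nhds_unique h1 h2
  rw [map_add, map_sub]
  linarith

/-- **Sweeping process in a Banach space, constant set, linear-growth perturbation.**
Let `B` be a separable, reflexive, uniformly smooth Banach space which is `I`-smoothly
weakly compact for an exponent `p ∈ [2,∞)`, `f : B → B` continuous with at most linear
growth, `r > 0`, and `C ⊂ B` nonempty, ball-compact and `(r,f)`-prox-regular. Then for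
every `u₀ ∈ C` the sweeping process `u̇(t) + N(C,u(t)) ∋ f(u(t))`, `u(0) = u₀`, has an
absolutely continuous solution `u` with `u(t) ∈ C` for all `t ∈ I`. -/
theorem sweeping_process_banach_constant
    {B : Type*} [NormedAddCommGroup B] [NormedSpace ℝ B] [CompleteSpace B]
    [TopologicalSpace.SeparableSpace B]
    (hrefl : ReflexiveSpace B) (hsmooth : UniformlySmooth B)
    (T : ℝ) (hT : 0 < T) (p : ℝ) (hp : 2 ≤ p)
    (hiswc : ISmoothlyWeaklyCompact (Set.Icc 0 T) B p)
    (f : B → B) (hfcont : Continuous f)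
    (L : ℝ) (hL : 0 < L) (hfgrowth : ∀ x, ‖f x‖ ≤ L * (1 + ‖x‖))
    (r : ℝ) (hr : 0 < r)
    (C : Set B) (hCne : C.Nonempty) (hCbc : BallCompact C)
    (hCprox : DirProxRegular r f C)
    (u₀ : B) (hu₀ : u₀ ∈ C) :
    ∃ u : ℝ → B, IsSweepingSol (fun _ => C) f T u₀ u := by
  set I : Set ℝ := Set.Icc 0 T with hI
  set R : ℝ := Real.exp (2 * L * T) * (1 + ‖u₀‖) with hR
  have hR0 : 0 < R := by positivity
  set M : ℝ := L * R with hM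
  have hM0 : 0 < M := by positivity
  set h : ℕ → ℝ := fun n => r / (2 * M) * (1 / ((n : ℝ) + 1)) with hh
  have hh0 : ∀ n, 0 < h n := fun n => by positivity
  have hhle : ∀ n, h n ≤ r / (2 * M) := by
    intro n
    refine mul_le_of_le_one_right (by positivity) ?_
    rw [div_le_one (by positivity)]
    linarith [Nat.cast_nonneg (α := ℝ) n]
  have hhr : ∀ n, h n * M < r := fun n =>
    calc h n * M ≤ r / (2 * M) * M := mul_le_mul_of_nonneg_right (hhle n) hM0.le
      _ = r / 2 := by field_simp
      _ < r := by linarith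
  have hhlim : Tendsto h atTop (𝓝 0) := by
    have h0 := (tendsto_one_div_add_atTop_nhds_zero_nat (𝕜 := ℝ)).const_mul (r / (2 * M))
    rw [mul_zero] at h0
    exact h0
  choose a b x ham hbm hxm hP using fun n =>
    hCprox.exists_approx hr hL hfgrowth hu₀ hR.ge (hh0 n) (hhr n)
  have hK : IsCompact (C ∩ Metric.closedBall (0 : B) R) := hCbc 0 R
  obtain ⟨κ, hκ, u, hu⟩ := exists_subseq_tendsto_of_norm_sub_le hK hT.le (a := a)
    (fun n t ht => ⟨(hP n t ht).1, by simpa using (hP n t ht).2.2.1⟩)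
    (D := 2 * M) (by positivity) hhlim (fun n t ht s hs => (hP n t ht).2.2.2.2.2.2.2.1 s hs)
  obtain ⟨k, hk, y, hym, ⟨My, hyM⟩, hweak, hJ⟩ := hiswc (fun n => x (κ n))
    (fun n => (hxm _).aestronglyMeasurable)
    ⟨M, fun n => (ae_restrict_iff' measurableSet_Icc).2
      (Eventually.of_forall fun t ht => (hP _ t ht).2.2.2.2.1)⟩
  set m : ℕ → ℕ := fun n => κ (k n) with hm
  have hmlim : Tendsto m atTop atTop := hκ.tendsto_atTop.comp hk.tendsto_atTop
  have hua : ∀ t ∈ I, Tendsto (fun n => a (m n) t) atTop (𝓝 (u t)) := fun t ht =>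
    (hu t ht).comp hk.tendsto_atTop
  have hub : ∀ t ∈ I, Tendsto (fun n => b (m n) t) atTop (𝓝 (u t)) := by
    intro t ht
    have h1 : Tendsto (fun n => b (m n) t - a (m n) t) atTop (𝓝 0) := by
      refine squeeze_zero_norm (a := fun n => 2 * M * h (m n))
        (fun n => (hP _ t ht).2.2.2.2.2.1) ?_
      simpa using (hhlim.comp hmlim).const_mul (2 * M)
    simpa using h1.add (hua t ht)
  have huK : ∀ t ∈ I, u t ∈ C ∩ Metric.closedBall (0 : B) R := fun t ht =>
    hK.isClosed.mem_of_tendsto (hua t ht) (Eventually.of_forall fun n =>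
      ⟨(hP _ t ht).1, by simpa using (hP _ t ht).2.2.1⟩)
  have hae : ∀ {P : ℝ → Prop}, (∀ t ∈ I, P t) → ∀ᵐ t ∂volume.restrict I, P t := fun hp =>
    (ae_restrict_iff' measurableSet_Icc).2 (Eventually.of_forall hp)
  have hum : AEStronglyMeasurable u (volume.restrict I) :=
    aestronglyMeasurable_of_tendsto_ae atTop (fun n => (ham (m n)).aestronglyMeasurable) (hae hua)
  have hfu : ∀ t ∈ I, Tendsto (fun n => f (a (m n) t)) atTop (𝓝 (f (u t))) := fun t ht =>
    (hfcont.tendsto _).comp (hua t ht)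
  have hfuM : ∀ t ∈ I, ‖f (u t)‖ ≤ M := fun t ht =>
    le_of_tendsto' (hfu t ht).norm fun n => (hP _ t ht).2.2.2.1
  have hfui : IntegrableOn (fun t => f (u t)) I :=
    Integrable.of_bound (hfcont.comp_aestronglyMeasurable hum) M (hae hfuM)
  have hyi : IntegrableOn y I := Integrable.of_bound hym My hyM
  have hxi : ∀ n, IntegrableOn (x (m n)) I := fun n =>
    Integrable.of_bound (hxm _).aestronglyMeasurable M
      (hae fun t ht => (hP _ t ht).2.2.2.2.1)
  refine ⟨u, fun t => f (u t) - y t, hfui.sub hyi, fun t ht => ?_, fun t ht => (huK t ht).1, ?_⟩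
  · refine eq_add_integral_of_tendsto (a := fun n => a (m n)) (F := fun n t => f (a (m n) t))
      (x := fun n => x (m n)) (M := M)
      (fun n => hfcont.comp_aestronglyMeasurable (ham (m n)).aestronglyMeasurable)
      (fun n t ht => (hP _ t ht).2.2.2.1) hfu hxi hfui hyi hweak ht (hua t ht) ?_
    refine squeeze_zero (fun _ => norm_nonneg _)
      (fun n => (hP (m n) t ht).2.2.2.2.2.2.2.2) ?_
    simpa using (hhlim.comp hmlim).const_mul (2 * M)
  have hcone : ∀ w ∈ C, ∀ᵐ t ∂volume.restrict I, ‖y t‖ ≤ ‖y t + (M / r) • (u t - w)‖ := by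
    intro w hw
    have hz : ∀ v : B, ‖v‖ ≤ R + 2 * M * (r / (2 * M)) →
        ‖(M / r) • (v - w)‖ ≤ M / r * (R + 2 * M * (r / (2 * M)) + ‖w‖) := fun v hv => by
      rw [norm_smul, Real.norm_of_nonneg (by positivity)]
      gcongr
      exact (norm_sub_le _ _).trans (by linarith)
    set M' := max M (max My (M / r * (R + 2 * M * (r / (2 * M)) + ‖w‖))) with hM'
    have hbR : ∀ n, ∀ t ∈ I, ‖b (m n) t‖ ≤ R + 2 * M * (r / (2 * M)) := by
      intro n t ht
      have h1 := (hP (m n) t ht).2.2.1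
      have h2 := (hP (m n) t ht).2.2.2.2.2.1
      have h4 := norm_add_le (b (m n) t - a (m n) t) (a (m n) t)
      rw [sub_add_cancel] at h4
      have h5 := mul_le_mul_of_nonneg_left (hhle (m n)) (by positivity : 0 ≤ 2 * M)
      linarith
    refine hsmooth.ae_norm_le_norm_add_of_tendsto hp (x := fun n => x (m n))
      (ζ := fun n t => (M / r) • (b (m n) t - w)) (M := M')
      (fun n => (hxm _).aestronglyMeasurable) hym
      ((hum.sub aestronglyMeasurable_const).const_smul (M / r))
      (fun n => (((hbm _).aestronglyMeasurable).sub aestronglyMeasurable_const).const_smul (M / r))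
      (hM0.le.trans (le_max_left _ _))
      (fun n => hae fun t ht => ((hP _ t ht).2.2.2.2.1).trans (le_max_left _ _))
      ?_ (hae fun t ht => ?_) (fun n => hae fun t ht => ?_) (hae fun t ht => ?_)
      (fun n => hae fun t ht => (hP _ t ht).2.2.2.2.2.2.1 w hw) (fun c _ φ hφ => ?_)
    · filter_upwards [hyM] with t ht
      exact ht.trans ((le_max_left _ _).trans (le_max_right _ _))
    · refine (hz _ ?_).trans ((le_max_right _ _).trans (le_max_right _ _))
      have h1 : ‖u t‖ ≤ R := by simpa using (huK t ht).2
      have h2 : 0 < 2 * M * (r / (2 * M)) := by positivity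
      linarith
    · exact (hz _ (hbR n t ht)).trans ((le_max_right _ _).trans (le_max_right _ _))
    · exact ((hub t ht).sub_const w).const_smul (M / r)
    · refine hJ (fun t => c • (M / r) • (u t - w))
        (((hum.sub aestronglyMeasurable_const).const_smul (M / r)).const_smul c)
        ⟨|c| * (M / r * (R + 2 * M * (r / (2 * M)) + ‖w‖)), hae fun t ht => ?_⟩ φ hφ
      rw [norm_smul, Real.norm_eq_abs]
      refine mul_le_mul_of_nonneg_left (hz _ ?_) (abs_nonneg _)
      have h1 : ‖u t‖ ≤ R := by simpa using (huK t ht).2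
      have h2 : 0 < 2 * M * (r / (2 * M)) := by positivity
      linarith
  obtain ⟨S, hSC, hScount, hSdense⟩ :=
    (TopologicalSpace.IsSeparable.of_separableSpace C).exists_countable_dense_subset
  filter_upwards [(ae_ball_iff hScount).2 fun w hw => hcone w (hSC hw),
    hae fun t ht => ht] with t ht htI
  rw [sub_sub_cancel]
  refine mem_proxNormalCone_of_norm_le (huK t htI).1 (s := r / M) (by positivity) fun w hw => ?_
  rw [inv_div]
  have hclosed : IsClosed {w | ‖y t‖ ≤ ‖y t + (M / r) • (u t - w)‖} :=
    isClosed_le continuous_const (by fun_prop)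
  exact hclosed.closure_subset_iff.2 ht (hSdense hw)
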